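/- For every pair of real numbers m ≤ M there exists a constant c > 0 such that Γ(a,b) ≥ c for all a ≥ 0 and all b ∈ [m, M]. -/

import Mathlib

noncomputable def Phi (x : ℝ) : ℝ :=
  (Real.sqrt (2 * Real.pi))⁻¹ * ∫ y in Set.Iic x, Real.exp (-y ^ 2 / 2)

/-- The function `Γ` from the paper (depending on the parameter `l`). -/
noncomputable def Gam (l a b : ℝ) : ℝ :=
  if 0 < a then
    l ^ 2 * Phi (-(l * b) / (2 * Real.sqrt a))
      + l ^ 2 * Real.exp (l ^ 2 * (a - b) / 2) * Phi (l * (b / (2 * Real.sqrt a) - Real.sqrt a))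
  else l ^ 2 * Real.exp (-(l ^ 2 * max b 0) / 2)

/-- The function `𝒢` from the paper (depending on the parameter `l`). -/
noncomputable def Gcal (l a b : ℝ) : ℝ :=
  if 0 < a then
    l ^ 2 * Real.exp (l ^ 2 * (a - b) / 2) * Phi (l * (b / (2 * Real.sqrt a) - Real.sqrt a))
  else if 0 < b then l ^ 2 * Real.exp (-(l ^ 2 * b) / 2) else 0

lemma integrable_exp_neg_sq_div_two :
    MeasureTheory.Integrable (fun y : ℝ => Real.exp (-y ^ 2 / 2)) := by
  convert integrable_exp_neg_mul_sq (b := 1 / 2) (by norm_num) using 3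
  ring

lemma Phi_pos (x : ℝ) : 0 < Phi x := by
  refine mul_pos (by positivity) ?_
  rw [MeasureTheory.setIntegral_pos_iff_support_of_nonneg_ae
    (Filter.Eventually.of_forall fun y => (Real.exp_pos _).le)
    integrable_exp_neg_sq_div_two.integrableOn]
  have hsupp : Function.support (fun y : ℝ => Real.exp (-y ^ 2 / 2)) = Set.univ :=
    Set.eq_univ_of_forall fun y => (Real.exp_pos _).ne'
  simp [hsupp]

lemma Phi_mono : Monotone Phi := fun _ _ hxy =>
  mul_le_mul_of_nonneg_left
    (MeasureTheory.setIntegral_mono_set integrable_exp_neg_sq_div_two.integrableOn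
      (Filter.Eventually.of_forall fun y => (Real.exp_pos _).le)
      (Set.Iic_subset_Iic.2 hxy).eventuallyLE)
    (by positivity)

/-- A lower bound for `Gam l a b` that is uniform in `a` and in `b ≤ K`: for `b ≤ 2 √a √K` it comes
from the first summand, otherwise from the second. -/
lemma le_Gam {l a b K : ℝ} (hl : 0 < l) (ha : 0 ≤ a) (hK : 0 ≤ K) (hbK : b ≤ K) :
    l ^ 2 * (Real.exp (-(l ^ 2 * K) / 2) * min (Phi (-(l * √K))) 1) ≤ Gam l a b := by
  have hp := Phi_pos (-(l * √K))
  have hmin : 0 < min (Phi (-(l * √K))) 1 := lt_min hp one_pos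
  have hl2 : 0 < l ^ 2 := by positivity
  unfold Gam
  split_ifs with h
  · have hs : 0 < √a := Real.sqrt_pos.2 h
    have hsK : 0 ≤ √K := Real.sqrt_nonneg K
    by_cases hb : b ≤ 2 * √a * √K
    · have harg : -(l * √K) ≤ -(l * b) / (2 * √a) := by
        rw [le_div_iff₀ (by positivity)]
        nlinarith
      have hexp : Real.exp (-(l ^ 2 * K) / 2) ≤ 1 :=
        Real.exp_le_one_iff.2 (by nlinarith)
      have hfirst : Real.exp (-(l ^ 2 * K) / 2) * min (Phi (-(l * √K))) 1
          ≤ Phi (-(l * b) / (2 * √a)) :=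
        (mul_le_of_le_one_left hmin.le hexp).trans ((min_le_left _ _).trans (Phi_mono harg))
      have hsecond := Phi_pos (l * (b / (2 * √a) - √a))
      exact le_add_of_le_of_nonneg (by gcongr) (by positivity)
    · push Not at hb
      have hb0 : 0 < b := lt_of_le_of_lt (by positivity) hb
      have hsa : √a ≤ √K := by
        by_contra! hlt
        nlinarith [Real.mul_self_sqrt hK]
      have hdiv : √K ≤ b / (2 * √a) := by
        rw [le_div_iff₀ (by positivity)]
        linarith
      have harg : -(l * √K) ≤ l * (b / (2 * √a) - √a) := by
        have : 0 ≤ l * (b / (2 * √a) - √a) := mul_nonneg hl.le (by linarith)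
        nlinarith
      have hexp : Real.exp (-(l ^ 2 * K) / 2) ≤ Real.exp (l ^ 2 * (a - b) / 2) :=
        Real.exp_le_exp.2 (by nlinarith)
      have hfirst := Phi_pos (-(l * b) / (2 * √a))
      refine le_add_of_nonneg_of_le (by positivity) ?_
      rw [mul_assoc]
      gcongr
      exact (min_le_left _ _).trans (Phi_mono harg)
  · have hexp : Real.exp (-(l ^ 2 * K) / 2) ≤ Real.exp (-(l ^ 2 * max b 0) / 2) := by
      gcongr
      exact max_le hbK hK
    gcongr
    exact (mul_le_of_le_one_right (Real.exp_pos _).le (min_le_right _ _)).trans hexp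

theorem stmt_2 (l : ℝ) (hl : 0 < l) (m M : ℝ) (hmM : m ≤ M) :
    ∃ c : ℝ, 0 < c ∧ ∀ a : ℝ, 0 ≤ a → ∀ b ∈ Set.Icc m M, c ≤ Gam l a b := by
  refine ⟨_, ?_, fun a ha b hb =>
    le_Gam hl ha (le_max_right M 0) (hb.2.trans (le_max_left M 0))⟩
  have hmin := lt_min (Phi_pos (-(l * √(max M 0)))) one_pos
  positivity
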